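/- Let p ∈ [0,1] and m ≥ 1 an integer. If t ∼ Bin(m,p), then E[D_KL(t/m, p)] ≤ 1/m, where D_KL(a,b) denotes the KL divergence between Bernoulli(a) and Bernoulli(b) (in bits), with the convention that it is 0 when a = b ∈ {0,1}. -/

import Mathlib

/-- The probability mass function of the binomial distribution `Bin(m,p)`. -/
def binomPMF (m : ℕ) (p : ℝ) (k : ℕ) : ℝ := (m.choose k : ℝ) * p ^ k * (1 - p) ^ (m - k)

/-- KL divergence (in bits) between Bernoulli(a) and Bernoulli(b); with Lean's conventions
    (`0 * x = 0`, `log 0 = 0`) this is `0` when `a = b ∈ {0,1}`. -/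
noncomputable def dklBer (a b : ℝ) : ℝ :=
  a * Real.logb 2 (a / b) + (1 - a) * Real.logb 2 ((1 - a) / (1 - b))

/-- Padé upper bound for the logarithm. -/
lemma log_le_pade (y : ℝ) (hy : 0 < y) :
    Real.log y ≤ (y - 1) * (y + 5) / (4 * y + 2) := by
  set f : ℝ → ℝ := fun y => (y - 1) * (y + 5) / (4 * y + 2) - Real.log y with hf
  have hder : ∀ x : ℝ, 0 < x →
      HasDerivAt f (4 * (x - 1) ^ 3 / (x * (4 * x + 2) ^ 2)) x := by
    intro x hx
    have h1 : HasDerivAt (fun y : ℝ => (y - 1) * (y + 5)) (1 * (x + 5) + (x - 1) * 1) x :=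
      ((hasDerivAt_id x).sub_const 1).mul ((hasDerivAt_id x).add_const 5)
    have h2 : HasDerivAt (fun y : ℝ => 4 * y + 2) (4 * 1) x :=
      ((hasDerivAt_id x).const_mul 4).add_const 2
    have hne : 4 * x + 2 ≠ 0 := by positivity
    refine ((h1.div h2 hne).sub (Real.hasDerivAt_log hx.ne')).congr_deriv ?_
    field_simp
    ring
  have hf1 : f 1 = 0 := by simp [hf]
  have key : 0 ≤ f y := by
    rcases le_total 1 y with h | h
    · have hm : MonotoneOn f (Set.Icc 1 y) := by
        apply monotoneOn_of_hasDerivWithinAt_nonneg (convex_Icc 1 y)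
          (f' := fun x => 4 * (x - 1) ^ 3 / (x * (4 * x + 2) ^ 2))
        · intro x hx
          exact (hder x (by linarith [hx.1])).continuousAt.continuousWithinAt
        · intro x hx
          rw [interior_Icc] at hx
          exact (hder x (by linarith [hx.1])).hasDerivWithinAt
        · intro x hx
          rw [interior_Icc] at hx
          have h0 : 0 ≤ x - 1 := by linarith [hx.1]
          have h1 : 0 < x := by linarith [hx.1]
          positivity
      have := hm (Set.left_mem_Icc.2 h) (Set.right_mem_Icc.2 h) h
      linarith
    · have hm : AntitoneOn f (Set.Icc y 1) := by
        apply antitoneOn_of_hasDerivWithinAt_nonpos (convex_Icc y 1)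
          (f' := fun x => 4 * (x - 1) ^ 3 / (x * (4 * x + 2) ^ 2))
        · intro x hx
          exact (hder x (by linarith [hx.1])).continuousAt.continuousWithinAt
        · intro x hx
          rw [interior_Icc] at hx
          exact (hder x (by linarith [hx.1])).hasDerivWithinAt
        · intro x hx
          rw [interior_Icc] at hx
          have h0 : 0 ≤ 1 - x := by linarith [hx.2]
          have h1 : 0 < x := by linarith [hx.1]
          apply div_nonpos_of_nonpos_of_nonneg
          · have : 0 ≤ (1 - x) ^ 3 := by positivity
            nlinarith
          · positivity
      have := hm (Set.left_mem_Icc.2 h) (Set.right_mem_Icc.2 h) h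
      linarith
  simp only [hf] at key
  linarith

lemma log_le_cubic (y : ℝ) (hy : 0 < y) :
    Real.log y ≤ (y - 1) - (y - 1) ^ 2 / 2 + (y - 1) ^ 3 / 3 := by
  refine (log_le_pade y hy).trans ?_
  rw [div_le_iff₀ (by positivity)]
  have : 0 ≤ (y - 1) ^ 4 := by positivity
  nlinarith

/-- Expectation under the binomial distribution. -/
noncomputable def binE (n : ℕ) (p : ℝ) (f : ℕ → ℝ) : ℝ :=
  ∑ k ∈ Finset.range (n + 1), binomPMF n p k * f k

lemma binomPMF_nonneg (n : ℕ) (p : ℝ) (h0 : 0 ≤ p) (h1 : p ≤ 1) (k : ℕ) :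
    0 ≤ binomPMF n p k := by
  unfold binomPMF
  have : 0 ≤ 1 - p := by linarith
  positivity

lemma binE_mono (n : ℕ) (p : ℝ) (h0 : 0 ≤ p) (h1 : p ≤ 1) (f g : ℕ → ℝ)
    (h : ∀ k, f k ≤ g k) : binE n p f ≤ binE n p g :=
  Finset.sum_le_sum fun k _ => mul_le_mul_of_nonneg_left (h k) (binomPMF_nonneg n p h0 h1 k)

lemma binE_add (n : ℕ) (p : ℝ) (f g : ℕ → ℝ) :
    binE n p (fun k => f k + g k) = binE n p f + binE n p g := by
  simp only [binE, mul_add, Finset.sum_add_distrib]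

lemma binE_smul (n : ℕ) (p c : ℝ) (f : ℕ → ℝ) :
    binE n p (fun k => c * f k) = c * binE n p f := by
  simp only [binE, Finset.mul_sum]
  exact Finset.sum_congr rfl fun k _ => by ring

lemma binE_succ (n : ℕ) (p : ℝ) (f : ℕ → ℝ) :
    binE (n + 1) p f = (1 - p) * binE n p f + p * binE n p (fun k => f (k + 1)) := by
  have h1 : (1 - p) * binE n p f = ∑ k ∈ Finset.range (n + 1 + 1),
      ((n.choose k : ℝ) * p ^ k * (1 - p) ^ (n + 1 - k)) * f k := by
    rw [Finset.sum_range_succ, Nat.choose_succ_self]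
    simp only [binE, Finset.mul_sum, binomPMF, Nat.cast_zero, zero_mul, add_zero]
    refine Finset.sum_congr rfl fun k hk => ?_
    have : n + 1 - k = (n - k) + 1 := by have := Finset.mem_range.1 hk; omega
    rw [this, pow_succ]; ring
  rw [h1, Finset.sum_range_succ']
  simp only [binE, Finset.mul_sum, binomPMF]
  rw [Finset.sum_range_succ', add_right_comm, ← Finset.sum_add_distrib]
  congr 1
  · refine Finset.sum_congr rfl fun k hk => ?_
    rw [Nat.choose_succ_succ]
    have : n + 1 - (k + 1) = n - k := by omega
    rw [this]; push_cast; ring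
  · simp

lemma binE_one (n : ℕ) (p : ℝ) : binE n p (fun _ => 1) = 1 := by
  induction n with
  | zero => simp [binE, binomPMF]
  | succ n ih => rw [binE_succ, ih]; ring

lemma binE_id (n : ℕ) (p : ℝ) : binE n p (fun k => (k : ℝ)) = n * p := by
  induction n with
  | zero => simp [binE, binomPMF]
  | succ n ih =>
    rw [binE_succ]
    simp only [Nat.cast_add, Nat.cast_one]
    rw [binE_add, ih, binE_one]; ring

lemma binE_sq (n : ℕ) (p : ℝ) :
    binE n p (fun k => (k : ℝ) ^ 2) = n * p * (1 - p) + n ^ 2 * p ^ 2 := by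
  induction n with
  | zero => simp [binE, binomPMF]
  | succ n ih =>
    rw [binE_succ]
    have : (fun k : ℕ => ((k + 1 : ℕ) : ℝ) ^ 2) =
        fun k : ℕ => (k : ℝ) ^ 2 + (2 * (k : ℝ) + 1) := by
      funext k; push_cast; ring
    rw [this, binE_add, binE_add, binE_smul, ih, binE_one, binE_id]; push_cast; ring

lemma binE_cube (n : ℕ) (p : ℝ) :
    binE n p (fun k => (k : ℝ) ^ 3) =
      n * p * (1 - p) * (1 - 2 * p) + 3 * (n * p) * (n * p * (1 - p)) + n ^ 3 * p ^ 3 := by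
  induction n with
  | zero => simp [binE, binomPMF]
  | succ n ih =>
    rw [binE_succ]
    have : (fun k : ℕ => ((k + 1 : ℕ) : ℝ) ^ 3) =
        fun k : ℕ => (k : ℝ) ^ 3 + (3 * (k : ℝ) ^ 2 + (3 * (k : ℝ) + 1)) := by
      funext k; push_cast; ring
    rw [this, binE_add, binE_add, binE_add, binE_smul, binE_smul, ih, binE_one, binE_id, binE_sq]
    push_cast; ring

lemma binE_cubic (n : ℕ) (p d C : ℝ) :
    binE n p (fun k => C + (((k : ℝ) - n * p) / d - (((k : ℝ) - n * p) / d) ^ 2 / 2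
      + (((k : ℝ) - n * p) / d) ^ 3 / 3)) =
    C - n * p * (1 - p) / (2 * d ^ 2) + n * p * (1 - p) * (1 - 2 * p) / (3 * d ^ 3) := by
  have : (fun k : ℕ => C + (((k : ℝ) - n * p) / d - (((k : ℝ) - n * p) / d) ^ 2 / 2
      + (((k : ℝ) - n * p) / d) ^ 3 / 3)) =
      fun k : ℕ => (d⁻¹ ^ 3 / 3) * (k : ℝ) ^ 3 +
        ((- d⁻¹ ^ 2 / 2 - d⁻¹ ^ 3 * (n * p)) * (k : ℝ) ^ 2 +
        ((d⁻¹ + d⁻¹ ^ 2 * (n * p) + d⁻¹ ^ 3 * (n * p) ^ 2) * (k : ℝ) +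
        (C - d⁻¹ * (n * p) - d⁻¹ ^ 2 * (n * p) ^ 2 / 2 - d⁻¹ ^ 3 * (n * p) ^ 3 / 3) * 1)) := by
    funext k; ring
  rw [this, binE_add, binE_add, binE_add, binE_smul, binE_smul, binE_smul, binE_smul,
    binE_one, binE_id, binE_sq, binE_cube]
  simp only [div_eq_mul_inv, mul_inv, inv_pow]
  ring

lemma binE_size_bias (n : ℕ) (p : ℝ) (f : ℕ → ℝ) :
    binE (n + 1) p (fun k => (k : ℝ) * f k) = (n + 1) * p * binE n p (fun k => f (k + 1)) := by
  simp only [binE]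
  rw [Finset.sum_range_succ', Finset.mul_sum]
  simp only [Nat.cast_zero, zero_mul, mul_zero, add_zero]
  refine Finset.sum_congr rfl fun k hk => ?_
  have h := Nat.add_one_mul_choose_eq n k
  have h' : ((n : ℝ) + 1) * (n.choose k : ℝ) = ((n + 1).choose (k + 1) : ℝ) * (k + 1) := by
    exact_mod_cast h
  have e : n + 1 - (k + 1) = n - k := by omega
  simp only [binomPMF, e]
  push_cast
  linear_combination (-(p * p ^ k * (1 - p) ^ (n - k) * f (k + 1))) * h'

lemma binE_reflect (n : ℕ) (p : ℝ) (f : ℝ → ℝ) :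
    binE n p (fun k => f ((n : ℝ) - k)) = binE n (1 - p) (fun k => f k) := by
  simp only [binE]
  rw [← Finset.sum_range_reflect]
  refine Finset.sum_congr rfl fun k hk => ?_
  have hk' : k ≤ n := by have := Finset.mem_range.1 hk; omega
  have e : n + 1 - 1 - k = n - k := by omega
  have e2 : n - (n - k) = k := by omega
  simp only [binomPMF, e, e2, Nat.choose_symm hk', Nat.cast_sub hk', sub_sub_cancel]
  ring

lemma rational_bound (L c : ℝ) (hL : 0 < L) (hc0 : 0 ≤ c) (hc : c ≤ 1 / 3) :
    (6 * L + 1) / (6 * L + 4) - (1 - c) * L ^ 2 / (2 * (L + 1) ^ 2)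
      + (1 - c) * L ^ 2 * (1 - c * L) / (3 * (L + 1) ^ 3) ≤ 69 / 100 := by
  have hq : 0 ≤ (69 / 100 * (6 * L + 4) - 6 * L - 1) * (L + 1) ^ 3 * 6
      + (1 - c) * L ^ 2 * (6 * L + 4) * (3 * (L + 1) - 2 * (1 - c * L)) := by
    have e0 : 0 ≤ 6.84 * L ^ 4 - 4.92 * L ^ 3 + 2.2 * L ^ 2 + 20.52 * L + 10.56 := by
      nlinarith [sq_nonneg (L ^ 2 - 0.36 * L), sq_nonneg L]
    have e1 : 0 ≤ (3 * 3.506 * L ^ 4 - 3 * 9.143 * L ^ 3 + 3 * 0.866 * L ^ 2 +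
        3 * 20.52 * L + 3 * 10.56) := by
      nlinarith [mul_nonneg hL.le (sq_nonneg (L - 2)), sq_nonneg (L ^ 2 - 1.3 * L - 1.7), sq_nonneg (L-2)]
    have h1 := mul_nonneg (by linarith : 0 ≤ 1 - 3 * c) e0
    have h2 := mul_nonneg hc0 e1
    have h3 : 0 ≤ c * (1 / 3 - c) * L ^ 4 :=
      mul_nonneg (mul_nonneg hc0 (by linarith)) (by positivity)
    have h4 : 0 ≤ c * (1 / 3 - c) * L ^ 3 :=
      mul_nonneg (mul_nonneg hc0 (by linarith)) (by positivity)
    have h5 : 0 ≤ c * L ^ 4 := by positivity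
    have h6 : 0 ≤ c * L ^ 3 := by positivity
    have h7 : 0 ≤ c * L ^ 2 := by positivity
    nlinarith
  have e : 69 / 100 - ((6 * L + 1) / (6 * L + 4) - (1 - c) * L ^ 2 / (2 * (L + 1) ^ 2)
      + (1 - c) * L ^ 2 * (1 - c * L) / (3 * (L + 1) ^ 3)) =
      ((69 / 100 * (6 * L + 4) - 6 * L - 1) * (L + 1) ^ 3 * 6
      + (1 - c) * L ^ 2 * (6 * L + 4) * (3 * (L + 1) - 2 * (1 - c * L))) /
      (6 * (L + 1) ^ 3 * (6 * L + 4)) := by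
    field_simp
    ring
  have : 0 ≤ ((69 / 100 * (6 * L + 4) - 6 * L - 1) * (L + 1) ^ 3 * 6
      + (1 - c) * L ^ 2 * (6 * L + 4) * (3 * (L + 1) - 2 * (1 - c * L))) /
      (6 * (L + 1) ^ 3 * (6 * L + 4)) := div_nonneg hq (by positivity)
  linarith

lemma one_side (n : ℕ) (p : ℝ) (hn : 2 ≤ n) (h0 : 0 < p) (h1 : p < 1) :
    (n + 1) * p * binE n p (fun k => Real.log (((k : ℝ) + 1) / ((n + 1) * p)))
      ≤ (1 - p) * (69 / 100) := by
  have hq : 0 < 1 - p := by linarith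
  have hn' : (2 : ℝ) ≤ n := by exact_mod_cast hn
  set d : ℝ := n * p + 1 with hd
  have hdpos : 0 < d := by positivity
  set L : ℝ := (n + 1) * p / (1 - p) with hL
  have hLpos : 0 < L := by positivity
  set C : ℝ := (6 * L + 1) / (6 * L + 4) / L with hC
  have hlog : Real.log (d / ((n + 1) * p)) ≤ C := by
    have e : d / ((n + 1) * p) = 1 + 1 / L := by
      rw [hL, hd]; field_simp; ring
    rw [e]
    refine (log_le_pade _ (by positivity)).trans (le_of_eq ?_)
    rw [hC]; field_simp; ring
  have hstep : binE n p (fun k => Real.log (((k : ℝ) + 1) / ((n + 1) * p))) ≤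
      C - n * p * (1 - p) / (2 * d ^ 2) + n * p * (1 - p) * (1 - 2 * p) / (3 * d ^ 3) := by
    rw [← binE_cubic]
    apply binE_mono n p h0.le h1.le
    intro k
    have e : ((k : ℝ) + 1) / ((n + 1) * p) = (((k : ℝ) + 1) / d) * (d / ((n + 1) * p)) := by
      field_simp
    rw [e, Real.log_mul (by positivity) (by positivity)]
    have h := log_le_cubic (((k : ℝ) + 1) / d) (by positivity)
    have e2 : ((k : ℝ) + 1) / d - 1 = ((k : ℝ) - n * p) / d := by
      field_simp; rw [hd]; ring
    rw [e2] at h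
    linarith
  have hr := rational_bound L (1 / (n + 1)) hLpos (by positivity)
    (by rw [div_le_div_iff₀ (by positivity) (by norm_num)]; linarith)
  have hL1 : L + 1 = d / (1 - p) := by
    rw [hL, hd]; field_simp; ring
  have hfin : (n + 1) * p * (C - n * p * (1 - p) / (2 * d ^ 2)
      + n * p * (1 - p) * (1 - 2 * p) / (3 * d ^ 3)) =
      (1 - p) * ((6 * L + 1) / (6 * L + 4)
      - (1 - 1 / ((n : ℝ) + 1)) * L ^ 2 / (2 * (L + 1) ^ 2)
      + (1 - 1 / ((n : ℝ) + 1)) * L ^ 2 * (1 - 1 / ((n : ℝ) + 1) * L) / (3 * (L + 1) ^ 3)) := by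
    have a1 : (n + 1) * p * C = (1 - p) * ((6 * L + 1) / (6 * L + 4)) := by
      have : ((n : ℝ) + 1) * p = (1 - p) * L := by rw [hL]; field_simp
      rw [this, hC]; field_simp
    have a2 : (n + 1) * p * (n * p * (1 - p) / (2 * d ^ 2)) =
        (1 - p) * ((1 - 1 / ((n : ℝ) + 1)) * L ^ 2 / (2 * (L + 1) ^ 2)) := by
      rw [hL1, hL]; field_simp; ring
    have a3 : (n + 1) * p * (n * p * (1 - p) * (1 - 2 * p) / (3 * d ^ 3)) =
        (1 - p) * ((1 - 1 / ((n : ℝ) + 1)) * L ^ 2 * (1 - 1 / ((n : ℝ) + 1) * L)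
          / (3 * (L + 1) ^ 3)) := by
      rw [hL1, hL]; field_simp; ring
    linear_combination a1 - a2 + a3
  calc _ ≤ _ := mul_le_mul_of_nonneg_left hstep (by positivity)
    _ = _ := hfin
    _ ≤ _ := mul_le_mul_of_nonneg_left hr hq.le

lemma expansion (n : ℕ) (p : ℝ) :
    (n + 1) * (Real.log 2 * ∑ t ∈ Finset.range (n + 1 + 1),
      binomPMF (n + 1) p t * dklBer ((t : ℝ) / (n + 1 : ℕ)) p) =
    (n + 1) * p * binE n p (fun k => Real.log (((k : ℝ) + 1) / ((n + 1) * p))) +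
    (n + 1) * (1 - p) * binE n (1 - p)
      (fun k => Real.log (((k : ℝ) + 1) / ((n + 1) * (1 - p)))) := by
  have hl : Real.log 2 ≠ 0 := (Real.log_pos (by norm_num)).ne'
  have hA := binE_size_bias n p (fun k => Real.log ((k : ℝ) / ((n + 1) * p)))
  have hB := binE_size_bias n (1 - p) (fun k => Real.log ((k : ℝ) / ((n + 1) * (1 - p))))
  have hR := binE_reflect (n + 1) p (fun x => x * Real.log (x / ((n + 1) * (1 - p))))
  push_cast at hA hB hR
  rw [← hA, ← hB, ← hR, ← binE_add, Finset.mul_sum, Finset.mul_sum]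
  refine Finset.sum_congr rfl fun k hk => ?_
  have hn : ((n : ℝ) + 1) ≠ 0 := by positivity
  have e1 : (k : ℝ) / (n + 1) / p = k / ((n + 1) * p) := by rw [div_div]
  have e2 : (1 - (k : ℝ) / (n + 1)) / (1 - p) = ((n : ℝ) + 1 - k) / ((n + 1) * (1 - p)) := by
    rw [← div_div, sub_div ((n : ℝ) + 1), div_self hn]
  simp only [dklBer, Real.logb, Nat.cast_add, Nat.cast_one, e1, e2]
  field_simp

lemma two_case (p : ℝ) (h0 : 0 < p) (h1 : p < 1) :
    p * Real.log (1 / (2 * p)) + (1 - p) * Real.log (1 / (2 * (1 - p)))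
      ≤ - 2 * (p - 1 / 2) ^ 2 := by
  have hq : 0 < 1 - p := by linarith
  have a := mul_le_mul_of_nonneg_left (log_le_pade (1 / (2 * p)) (by positivity)) h0.le
  have b := mul_le_mul_of_nonneg_left (log_le_pade (1 / (2 * (1 - p))) (by positivity)) hq.le
  have ea : p * ((1 / (2 * p) - 1) * (1 / (2 * p) + 5) / (4 * (1 / (2 * p)) + 2)) =
      (1 - 2 * p) * (1 + 10 * p) / (8 * (1 + p)) := by
    field_simp; ring
  have eb : (1 - p) * ((1 / (2 * (1 - p)) - 1) * (1 / (2 * (1 - p)) + 5) /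
      (4 * (1 / (2 * (1 - p))) + 2)) =
      (1 - 2 * (1 - p)) * (1 + 10 * (1 - p)) / (8 * (1 + (1 - p))) := by
    field_simp; ring
  rw [ea] at a
  rw [eb] at b
  have hc : (1 - 2 * p) * (1 + 10 * p) / (8 * (1 + p)) +
      (1 - 2 * (1 - p)) * (1 + 10 * (1 - p)) / (8 * (1 + (1 - p))) ≤
      - 2 * (p - 1 / 2) ^ 2 := by
    rw [div_add_div _ _ (by positivity) (by positivity), div_le_iff₀ (by positivity)]
    have : 0 ≤ (p - 1 / 2) ^ 4 := by positivity
    nlinarith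
  linarith

/-- If `t ∼ Bin(m,p)` then `E[D_KL(t/m, p)] ≤ 1/m`. -/
theorem expected_dkl_le (m : ℕ) (p : ℝ) (hm : 1 ≤ m) (hp0 : 0 ≤ p) (hp1 : p ≤ 1) :
    ∑ t ∈ Finset.range (m + 1), binomPMF m p t * dklBer ((t : ℝ) / m) p ≤ 1 / m := by
  obtain ⟨n, rfl⟩ : ∃ n, m = n + 1 := ⟨m - 1, by omega⟩
  have hl : 0 < Real.log 2 := Real.log_pos (by norm_num)
  have hl1 := Real.log_two_gt_d9
  have hl2 := Real.log_two_lt_d9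
  have hmain : (n + 1) * (Real.log 2 * ∑ t ∈ Finset.range (n + 1 + 1),
      binomPMF (n + 1) p t * dklBer ((t : ℝ) / (n + 1 : ℕ)) p) ≤ Real.log 2 := by
    have hn : ((n : ℝ) + 1) ≠ 0 := by positivity
    rcases hp0.eq_or_lt with rfl | h0
    · rw [Finset.sum_eq_single 0]
      · simp [dklBer, hl.le]
      · intro b _ hb; simp [binomPMF, hb]
      · simp
    rcases hp1.eq_or_lt with rfl | h1
    · rw [Finset.sum_eq_single (n + 1)]
      · have : ((n + 1 : ℕ) : ℝ) / (n + 1 : ℕ) = 1 := div_self (by push_cast; exact hn)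
        simp only [dklBer, this]
        simp [hl.le]
      · intro b hb hb'
        have : n + 1 - b ≠ 0 := by have := Finset.mem_range.1 hb; omega
        simp [binomPMF, this]
      · simp
    have hq : 0 < 1 - p := by linarith
    rw [expansion]
    have h2 := two_case p h0 h1
    rw [one_div, one_div, Real.log_inv, Real.log_inv, Real.log_mul two_ne_zero h0.ne',
      Real.log_mul two_ne_zero hq.ne'] at h2
    rcases Nat.lt_or_ge n 2 with hn2 | hn2
    · interval_cases n
      · simp [binE, binomPMF]
        nlinarith [sq_nonneg (p - 1 / 2)]
      · have e1 : Real.log (1 / (2 * p)) = - Real.log 2 - Real.log p := by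
          rw [one_div, Real.log_inv, Real.log_mul two_ne_zero h0.ne']; ring
        have e2 : Real.log (1 / (2 * (1 - p))) = - Real.log 2 - Real.log (1 - p) := by
          rw [one_div, Real.log_inv, Real.log_mul two_ne_zero hq.ne']; ring
        have e3 : Real.log (2 / (2 * p)) = - Real.log p := by
          rw [Real.log_div two_ne_zero (by positivity), Real.log_mul two_ne_zero h0.ne']; ring
        have e4 : Real.log (2 / (2 * (1 - p))) = - Real.log (1 - p) := by
          rw [Real.log_div two_ne_zero (by positivity), Real.log_mul two_ne_zero hq.ne']; ring
        have o : (1 : ℝ) + 1 = 2 := by norm_num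
        simp only [binE, binomPMF, Finset.sum_range_succ, Finset.sum_range_zero, Nat.cast_one,
          Nat.cast_zero, zero_add, o, e1, e2, e3, e4]
        simp
        nlinarith [mul_nonneg (by linarith : 0 ≤ 1 - Real.log 2) (sq_nonneg (p - 1 / 2))]
    · have a := one_side n p hn2 h0 h1
      have b := one_side n (1 - p) hn2 hq (by linarith)
      linarith
  have hpos : (0 : ℝ) < (n : ℝ) + 1 := by positivity
  rw [le_div_iff₀ (by push_cast; exact hpos)]
  push_cast at hmain ⊢
  refine le_of_mul_le_mul_left ?_ hl
  linarith
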